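/- arXiv:cond-mat/0301163 — 2 statements merged into one kernel-verified Lean document; each statement's English description precedes it below -/
import Mathlib

section
/- For any b > 0 there is a constant c > 0 (determined by b, v_min, v_max) such that for any integrated Poisson random variable Z on (v_min, v_max) and all 0 < B < b·σ_Z, one has P(|Z − μ_Z| > B·σ_Z) ≤ 2·exp(−c·B²). -/
open MeasureTheory ProbabilityTheory Real
open scoped Classical

/-- If the outer measures of a set and its complement add up to at most the total mass, the set is
null-measurable. -/
lemma nullMeasurableSet_of_measure_add_compl_le {Ω : Type*} [MeasurableSpace Ω] {μ : Measure Ω}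
    [IsFiniteMeasure μ] {A : Set Ω} (h : μ A + μ Aᶜ ≤ μ Set.univ) : NullMeasurableSet A μ := by
  set S := toMeasurable μ A
  set T := toMeasurable μ Aᶜ
  have hST : S ∪ T = Set.univ := by
    refine Set.eq_univ_of_univ_subset fun x _ => ?_
    by_cases hx : x ∈ A
    · exact Or.inl (subset_toMeasurable μ A hx)
    · exact Or.inr (subset_toMeasurable μ Aᶜ hx)
  have hinter : μ (S ∩ T) = 0 := by
    have h2 := measure_union_add_inter (μ := μ) S (measurableSet_toMeasurable μ Aᶜ)
    rw [hST, measure_toMeasurable, measure_toMeasurable] at h2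
    have h3 : μ Set.univ + μ (S ∩ T) ≤ μ Set.univ + 0 := by
      rw [add_zero]
      exact h2.trans_le h
    exact le_antisymm ((ENNReal.add_le_add_iff_left (measure_ne_top μ _)).1 h3) bot_le
  have hdiff : μ (S \ A) = 0 :=
    measure_mono_null (t := S ∩ T) (fun x hx => ⟨hx.1, subset_toMeasurable μ Aᶜ hx.2⟩) hinter
  have hSA : (S : Set Ω) =ᵐ[μ] A :=
    (ae_le_set.2 hdiff).antisymm (subset_toMeasurable μ A).eventuallyLE
  exact (measurableSet_toMeasurable μ A).nullMeasurableSet.congr hSA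

/-- A natural-valued function whose level sets have outer measures adding up to the total mass is
almost everywhere measurable. -/
lemma aemeasurable_of_tsum_measure_fiber_le {Ω : Type*} [MeasurableSpace Ω] {μ : Measure Ω}
    [IsFiniteMeasure μ] {X : Ω → ℕ} (h : ∑' n, μ {ω | X ω = n} ≤ μ Set.univ) :
    AEMeasurable X μ := by
  have hfib : ∀ n, NullMeasurableSet {ω | X ω = n} μ := by
    intro n
    refine nullMeasurableSet_of_measure_add_compl_le (le_trans ?_ h)
    rw [ENNReal.tsum_eq_add_tsum_ite n]
    gcongr
    calc μ {ω | X ω = n}ᶜ ≤ μ (⋃ k, if k = n then ∅ else {ω | X ω = k}) := by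
          refine measure_mono fun ω hω => Set.mem_iUnion.2 ⟨X ω, ?_⟩
          rw [if_neg (show ¬ X ω = n from hω)]
          rfl
      _ ≤ ∑' k, μ (if k = n then ∅ else {ω | X ω = k}) := measure_iUnion_le _
      _ = _ := by
          congr 1
          ext k
          split_ifs <;> simp
  refine NullMeasurable.aemeasurable fun s _ => ?_
  have : X ⁻¹' s = ⋃ n ∈ s, {ω | X ω = n} := by
    ext ω
    simp
  rw [this]
  exact NullMeasurableSet.biUnion s.to_countable fun n _ => hfib n

/-- A function with Poisson point probabilities is almost everywhere measurable. -/
lemma aemeasurable_of_poisson {Ω : Type*} [MeasurableSpace Ω] {μ : Measure Ω}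
    [IsProbabilityMeasure μ] {X : Ω → ℕ} {l : ℝ} (hl : 0 ≤ l)
    (hX : ∀ n : ℕ, μ {ω | X ω = n} = ENNReal.ofReal (exp (-l) * l ^ n / n.factorial)) :
    AEMeasurable X μ := by
  refine aemeasurable_of_tsum_measure_fiber_le ?_
  have hs := hasSum_one_poissonMeasure ⟨l, hl⟩
  change HasSum (fun n : ℕ => exp (-l) * l ^ n / n.factorial) 1 at hs
  simp_rw [hX]
  rw [← ENNReal.ofReal_tsum_of_nonneg (fun n => by positivity) hs.summable, hs.tsum_eq]
  simp

/-- The exponential moments of a centred Poisson variable. -/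
lemma lintegral_exp_centred_poisson {Ω : Type*} [MeasurableSpace Ω] {μ : Measure Ω}
    [IsProbabilityMeasure μ] {X : Ω → ℕ} {l : ℝ} (hl : 0 ≤ l)
    (hX : ∀ n : ℕ, μ {ω | X ω = n} = ENNReal.ofReal (exp (-l) * l ^ n / n.factorial)) (θ : ℝ) :
    ∫⁻ ω, ENNReal.ofReal (exp (θ * (X ω - l))) ∂μ
      = ENNReal.ofReal (exp (l * (exp θ - 1 - θ))) := by
  have hm := aemeasurable_of_poisson hl hX
  have hmap : ∫⁻ ω, ENNReal.ofReal (exp (θ * (X ω - l))) ∂μ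
      = ∫⁻ n, ENNReal.ofReal (exp (θ * ((n : ℕ) - l))) ∂(μ.map X) :=
    (lintegral_map' (f := fun n : ℕ => ENNReal.ofReal (exp (θ * (n - l))))
      AEMeasurable.of_discrete hm).symm
  have hpt : ∀ n, (μ.map X) {n} = ENNReal.ofReal (exp (-l) * l ^ n / n.factorial) := by
    intro n
    rw [Measure.map_apply_of_aemeasurable hm (measurableSet_singleton n), ← hX n]
    rfl
  have hs : HasSum (fun n : ℕ => exp (θ * (n - l)) * (exp (-l) * l ^ n / n.factorial))
      (exp (l * (exp θ - 1 - θ))) := by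
    convert! (NormedSpace.expSeries_div_hasSum_exp (l * exp θ)).mul_left (exp (-l - θ * l)) using 1
    · ext n
      have h1 : exp (θ * (n - l)) = exp (-(θ * l)) * exp θ ^ n := by
        rw [← exp_nat_mul, ← exp_add]
        ring_nf
      rw [h1, mul_pow, sub_eq_add_neg, exp_add]
      ring
    · rw [← exp_eq_exp_ℝ, ← exp_add]
      ring_nf
  rw [hmap, lintegral_countable']
  simp_rw [hpt, ← ENNReal.ofReal_mul (exp_pos _).le]
  rw [← ENNReal.ofReal_tsum_of_nonneg (fun n => by positivity) hs.summable, hs.tsum_eq]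

/-- Chernoff bound for an average of (arbitrarily dependent) centred Poisson variables. -/
lemma measure_average_poisson_ge_le {Ω : Type*} [MeasurableSpace Ω] {μ : Measure Ω}
    [IsProbabilityMeasure μ] {m : ℕ} (hm : 0 < m) {X : ℕ → Ω → ℕ} {l : ℕ → ℝ} {L : ℝ}
    (hl : ∀ j, 0 ≤ l j) (hL : ∀ j, l j ≤ L)
    (hX : ∀ j, ∀ n : ℕ,
      μ {ω | X j ω = n} = ENNReal.ofReal (exp (-l j) * l j ^ n / n.factorial))
    {θ : ℝ} (hθ : |θ| ≤ 1) (r : ℝ) :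
    μ {ω | r ≤ θ * ((1 / m) * ∑ j ∈ Finset.range m, ((X j ω : ℝ) - l j))}
      ≤ ENNReal.ofReal (exp (L * θ ^ 2 - r)) := by
  have hm' : (0 : ℝ) < m := by exact_mod_cast hm
  set f : Ω → ENNReal := fun ω =>
    ∑ j ∈ Finset.range m, ENNReal.ofReal ((1 / m) * exp (θ * (X j ω - l j))) with hf
  have hmeas : ∀ j, AEMeasurable (fun ω => ENNReal.ofReal ((1 / m) * exp (θ * (X j ω - l j)))) μ :=
    fun j => (Measurable.of_discrete (f := fun n : ℕ =>
      ENNReal.ofReal ((1 / m) * exp (θ * (n - l j))))).comp_aemeasurable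
        (aemeasurable_of_poisson (hl j) (hX j))
  have hfm : AEMeasurable f μ := Finset.aemeasurable_fun_sum _ fun j _ => hmeas j
  have hsub : {ω | r ≤ θ * ((1 / m) * ∑ j ∈ Finset.range m, ((X j ω : ℝ) - l j))}
      ⊆ {ω | ENNReal.ofReal (exp r) ≤ f ω} := by
    intro ω hω
    have hω' : r ≤ θ * ((1 / m) * ∑ j ∈ Finset.range m, ((X j ω : ℝ) - l j)) := hω
    have hj := convexOn_exp.map_sum_le (t := Finset.range m) (w := fun _ => (1 / m : ℝ))
      (p := fun j => θ * (X j ω - l j)) (fun _ _ => by positivity)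
      (by simp [hm'.ne']) (fun _ _ => Set.mem_univ _)
    simp only [smul_eq_mul] at hj
    change ENNReal.ofReal (exp r) ≤ ∑ j ∈ Finset.range m, _
    rw [← ENNReal.ofReal_sum_of_nonneg (fun j _ => by positivity)]
    refine ENNReal.ofReal_le_ofReal ((exp_le_exp.2 (hω'.trans_eq ?_)).trans hj)
    simp_rw [Finset.mul_sum]
    exact Finset.sum_congr rfl fun j _ => by ring
  have hint : ∫⁻ ω, f ω ∂μ ≤ ENNReal.ofReal (exp (L * θ ^ 2)) := by
    rw [hf, lintegral_finsetSum' _ fun j _ => hmeas j]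
    calc ∑ j ∈ Finset.range m, ∫⁻ ω, ENNReal.ofReal ((1 / m) * exp (θ * (X j ω - l j))) ∂μ
        ≤ ∑ j ∈ Finset.range m, ENNReal.ofReal ((1 / m) * exp (L * θ ^ 2)) := by
          refine Finset.sum_le_sum fun j _ => ?_
          simp_rw [ENNReal.ofReal_mul (show (0 : ℝ) ≤ 1 / m by positivity)]
          rw [lintegral_const_mul' _ _ ENNReal.ofReal_ne_top,
            lintegral_exp_centred_poisson (hl j) (hX j)]
          have hexp : l j * (exp θ - 1 - θ) ≤ L * θ ^ 2 :=
            mul_le_mul (hL j) ((le_abs_self _).trans (abs_exp_sub_one_sub_id_le hθ))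
              (by linarith [add_one_le_exp θ]) ((hl j).trans (hL j))
          gcongr
      _ = ENNReal.ofReal (exp (L * θ ^ 2)) := by
          rw [← ENNReal.ofReal_sum_of_nonneg (fun j _ => by positivity)]
          congr 1
          simp only [Finset.sum_const, Finset.card_range, nsmul_eq_mul]
          field_simp
  calc _ ≤ μ {ω | ENNReal.ofReal (exp r) ≤ f ω} := measure_mono hsub
    _ ≤ (∫⁻ ω, f ω ∂μ) / ENNReal.ofReal (exp r) :=
        meas_ge_le_lintegral_div hfm (by simp [exp_pos]) ENNReal.ofReal_ne_top
    _ ≤ ENNReal.ofReal (exp (L * θ ^ 2)) / ENNReal.ofReal (exp r) := by gcongr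
    _ = ENNReal.ofReal (exp (L * θ ^ 2 - r)) := by
        rw [← ENNReal.ofReal_div_of_pos (exp_pos r), exp_sub]

/-- A layer-cake sum over the levels `u j`: the discretisation of `v` by step size `d`. -/
noncomputable def layerSum (d : ℝ) (m : ℕ) (u : ℕ → ℝ) (v : ℝ) : ℝ :=
  d * ∑ j ∈ Finset.range m, if u j < v then 1 else 0

lemma layerSum_eq_ceil {V v a : ℝ} {m : ℕ} (hV : 0 < V) (hm : 0 < m) (hv : v < V) (ha : 0 ≤ a) :
    layerSum (V / m) m (fun j => (j + a) * (V / m)) v = V / m * ⌈v / (V / m) - a⌉₊ := by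
  have hm' : (0 : ℝ) < m := by exact_mod_cast hm
  have hd : 0 < V / m := by positivity
  have hceil : ⌈v / (V / m) - a⌉₊ ≤ m := by
    rw [Nat.ceil_le]
    have : v / (V / m) ≤ m := by
      rw [div_le_iff₀ hd]
      calc v ≤ V := hv.le
        _ = m * (V / m) := by field_simp
    linarith
  rw [layerSum, Finset.sum_boole]
  congr 3
  rw [← Finset.card_range ⌈v / (V / m) - a⌉₊]
  congr 1
  ext j
  rw [Finset.mem_filter, Finset.mem_range, Finset.mem_range, Nat.lt_ceil, lt_sub_iff_add_lt,
    lt_div_iff₀ hd]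
  refine ⟨fun h => h.2, fun h => ⟨?_, h⟩⟩
  refine lt_of_lt_of_le (Nat.lt_ceil.2 ?_) hceil
  rwa [lt_sub_iff_add_lt, lt_div_iff₀ hd]

lemma le_layerSum_upper {V v : ℝ} {m : ℕ} (hm : 0 < m) (hv0 : 0 < v) (hv : v < V) :
    v ≤ layerSum (V / m) m (fun j => (j + 0) * (V / m)) v ∧
      layerSum (V / m) m (fun j => (j + 0) * (V / m)) v ≤ v + V / m := by
  have hV : 0 < V := hv0.trans hv
  have hd : 0 < V / m := div_pos hV (by exact_mod_cast hm)
  have hvd : V / m * (v / (V / m)) = v := by field_simp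
  rw [layerSum_eq_ceil hV hm hv le_rfl, sub_zero]
  constructor
  · calc v = V / m * (v / (V / m)) := hvd.symm
      _ ≤ _ := by gcongr; exact Nat.le_ceil _
  · calc _ ≤ V / m * (v / (V / m) + 1) := by
          gcongr
          exact (Nat.ceil_lt_add_one (by positivity)).le
      _ = v + V / m := by rw [mul_add, hvd, mul_one]

lemma le_layerSum_lower {V v : ℝ} {m : ℕ} (hm : 0 < m) (hv0 : 0 < v) (hv : v < V) :
    v - V / m ≤ layerSum (V / m) m (fun j => (j + 1) * (V / m)) v ∧
      layerSum (V / m) m (fun j => (j + 1) * (V / m)) v ≤ v := by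
  have hV : 0 < V := hv0.trans hv
  have hd : 0 < V / m := div_pos hV (by exact_mod_cast hm)
  have hvd : V / m * (v / (V / m)) = v := by field_simp
  rw [layerSum_eq_ceil hV hm hv zero_le_one]
  constructor
  · calc v - V / m = V / m * (v / (V / m) - 1) := by rw [mul_sub, hvd, mul_one]
      _ ≤ _ := by gcongr; exact Nat.le_ceil _
  · calc _ ≤ V / m * (v / (V / m)) := by
          gcongr
          rcases le_total 0 (v / (V / m) - 1) with h | h
          · linarith [Nat.ceil_lt_add_one h]
          · rw [Nat.ceil_eq_zero.2 h]
            simp only [Nat.cast_zero]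
            positivity
      _ = v := hvd

lemma sum_card_filter_eq_sum_layerSum (d : ℝ) (m : ℕ) (u : ℕ → ℝ) (M : Multiset ℝ) :
    d * ∑ j ∈ Finset.range m, ((Multiset.card (M.filter (· ∈ Set.Ioi (u j))) : ℕ) : ℝ)
      = (M.map (layerSum d m u)).sum := by
  induction M using Multiset.induction_on with
  | empty => simp
  | cons a M ih =>
    rw [Multiset.map_cons, Multiset.sum_cons, ← ih, layerSum, ← mul_add, ← Finset.sum_add_distrib]
    congr 1
    refine Finset.sum_congr rfl fun j _ => ?_
    by_cases h : u j < a
    · rw [Multiset.filter_cons_of_pos _ (show a ∈ Set.Ioi (u j) from h), Multiset.card_cons,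
        if_pos h]
      push_cast
      ring
    · rw [Multiset.filter_cons_of_neg _ (show ¬ a ∈ Set.Ioi (u j) from h), if_neg h, zero_add]

lemma integrable_layerSum_mul {p : ℝ → ℝ} (hp : Integrable p) (d : ℝ) (m : ℕ) (u : ℕ → ℝ) :
    Integrable (fun v => layerSum d m u v * p v) ∧
      d * ∑ j ∈ Finset.range m, ∫ v in Set.Ioi (u j), p v = ∫ v, layerSum d m u v * p v := by
  have heq : (fun v => layerSum d m u v * p v)
      = fun v => d * ∑ j ∈ Finset.range m, (Set.Ioi (u j)).indicator p v := by
    ext v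
    rw [layerSum, mul_assoc, Finset.sum_mul]
    congr 1
    refine Finset.sum_congr rfl fun j _ => ?_
    simp [Set.indicator_apply]
  have hi : ∀ j ∈ Finset.range m, Integrable ((Set.Ioi (u j)).indicator p) :=
    fun j _ => hp.indicator measurableSet_Ioi
  rw [heq]
  refine ⟨(integrable_finsetSum _ hi).const_mul d, ?_⟩
  rw [integral_const_mul, integral_finsetSum _ hi]
  simp_rw [integral_indicator measurableSet_Ioi]

/-- Gaussian-type deviation bound for an integrated Poisson random variable:
for any `b > 0` there is `c > 0` (determined by `b, vmin, vmax`) such that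
`P(|Z - μ_Z| > B σ_Z) ≤ 2 exp(-c B²)` for all `0 < B < b σ_Z`. -/
theorem integratedPoisson_gaussian_deviation
    (vmin vmax b : ℝ) (h0 : 0 < vmin) (h1 : vmin < vmax) (hb : 0 < b) :
    ∃ c > 0, ∀ {Ω : Type} [MeasurableSpace Ω] (μ : Measure Ω), IsProbabilityMeasure μ →
      ∀ (pd : ℝ → ℝ), (∀ v, 0 ≤ pd v) →
      IntegrableOn pd (Set.Ioo vmin vmax) →
      IntegrableOn (fun v => v * pd v) (Set.Ioo vmin vmax) →
      IntegrableOn (fun v => v ^ 2 * pd v) (Set.Ioo vmin vmax) →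
      (∀ v, v ∉ Set.Ioo vmin vmax → pd v = 0) →
      ∀ (P : Ω → Multiset ℝ), (∀ ω, ∀ v ∈ P ω, v ∈ Set.Ioo vmin vmax) →
      (∀ s : Set ℝ, MeasurableSet s → ∀ n : ℕ,
        μ {ω | Multiset.card ((P ω).filter (· ∈ s)) = n}
          = ENNReal.ofReal
              (Real.exp (-(∫ v in s, pd v)) * (∫ v in s, pd v) ^ n / n.factorial)) →
      (∀ s t : Set ℝ, MeasurableSet s → MeasurableSet t → Disjoint s t →
        IndepFun (fun ω => Multiset.card ((P ω).filter (· ∈ s)))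
                 (fun ω => Multiset.card ((P ω).filter (· ∈ t))) μ) →
      ∀ (Z : Ω → ℝ), (∀ ω, Z ω = (P ω).sum) →
      ∀ B : ℝ, 0 < B →
        B < b * Real.sqrt (∫ v in Set.Ioo vmin vmax, v ^ 2 * pd v) →
        μ {ω | Real.sqrt (∫ v in Set.Ioo vmin vmax, v ^ 2 * pd v) * B
              < |Z ω - ∫ v in Set.Ioo vmin vmax, v * pd v|}
          ≤ ENNReal.ofReal (2 * Real.exp (-c * B ^ 2)) := by
  have hV : 0 < vmax := h0.trans h1
  set K : ℝ := (vmax / vmin) ^ 2 with hK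
  have hKpos : 0 < K := by positivity
  set s : ℝ := min (1 / (b * vmax)) (1 / (2 * K)) with hs
  have hspos : 0 < s := lt_min (by positivity) (by positivity)
  have hs1 : s * (b * vmax) ≤ 1 := (le_div_iff₀ (by positivity)).1 (min_le_left _ _)
  have hs2 : s * (2 * K) ≤ 1 := (le_div_iff₀ (by positivity)).1 (min_le_right _ _)
  refine ⟨s / 4, by positivity, ?_⟩
  intro Ω _ μ hμ pd hpd hi0 hi1 hi2 hout P hP hpois _ Z hZ B hB hBb
  set σ : ℝ := √(∫ v in Set.Ioo vmin vmax, v ^ 2 * pd v) with hσ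
  have hσpos : 0 < σ := pos_of_mul_pos_right (hB.trans hBb) hb.le
  have hsub : ∀ g : ℝ → ℝ, ∫ v in Set.Ioo vmin vmax, g v * pd v = ∫ v, g v * pd v := fun g =>
    setIntegral_eq_integral_of_forall_compl_eq_zero fun v hv => by rw [hout v hv, mul_zero]
  have hint : ∀ g : ℝ → ℝ, IntegrableOn (fun v => g v * pd v) (Set.Ioo vmin vmax) →
      Integrable fun v => g v * pd v := by
    intro g hg
    refine (integrableOn_iff_integrable_of_support_subset fun v hv => ?_).1 hg
    by_contra hv'
    exact hv (by simp [hout v hv'])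
  have hi : Integrable pd := by
    simpa using hint (fun _ => 1) (by simpa using hi0)
  replace hi1 := hint _ hi1
  replace hi2 := hint _ hi2
  have hσ2 : σ ^ 2 = ∫ v, v ^ 2 * pd v := by
    rw [hσ, sq_sqrt (integral_nonneg fun v => mul_nonneg (sq_nonneg v) (hpd v)), hsub]
  set L : ℝ := ∫ v, pd v with hL
  set ν : ℝ := ∫ v in Set.Ioo vmin vmax, v * pd v with hν
  rw [hsub] at hν
  have hL0 : 0 ≤ L := integral_nonneg hpd
  have hmono : ∀ f g : ℝ → ℝ, Integrable (fun v => f v * pd v) → Integrable (fun v => g v * pd v) →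
      (∀ v ∈ Set.Ioo vmin vmax, f v ≤ g v) → ∫ v, f v * pd v ≤ ∫ v, g v * pd v := by
    intro f g hf hg hfg
    refine integral_mono hf hg fun v => ?_
    by_cases hv : v ∈ Set.Ioo vmin vmax
    · exact mul_le_mul_of_nonneg_right (hfg v hv) (hpd v)
    · simp [hout v hv]
  have hLσ : vmin ^ 2 * L ≤ σ ^ 2 := by
    rw [hσ2, hL, ← integral_const_mul]
    refine hmono (fun _ => vmin ^ 2) (fun v => v ^ 2) (hi.const_mul _) hi2 fun v hv => ?_
    exact pow_le_pow_left₀ h0.le hv.1.le 2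
  set t : ℝ := s * B / σ with ht
  have htpos : 0 < t := by positivity
  have htσ : t * σ = s * B := by rw [ht]; field_simp
  have htV : t * vmax ≤ 1 := by
    rw [ht, div_mul_eq_mul_div, div_le_one hσpos]
    calc s * B * vmax ≤ s * (b * σ) * vmax := by gcongr
      _ = s * (b * vmax) * σ := by ring
      _ ≤ 1 * σ := by gcongr
      _ = σ := one_mul σ
  have hquad : L * (t * vmax) ^ 2 ≤ s * B ^ 2 / 2 := by
    have h2 : L ≤ σ ^ 2 / vmin ^ 2 := by
      rw [le_div_iff₀ (by positivity)]
      linarith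
    calc L * (t * vmax) ^ 2 ≤ σ ^ 2 / vmin ^ 2 * (t * vmax) ^ 2 := by gcongr
      _ = (t * σ) ^ 2 * K := by rw [hK]; field_simp
      _ = s * B ^ 2 * (s * (2 * K)) / 2 := by rw [htσ]; ring
      _ ≤ s * B ^ 2 * 1 / 2 := by gcongr
      _ = s * B ^ 2 / 2 := by ring
  obtain ⟨m, hm⟩ := exists_nat_gt (vmax * L / (σ * B / 4))
  have hmpos' : (0 : ℝ) < m := lt_of_le_of_lt (by positivity) hm
  have hmpos : 0 < m := by exact_mod_cast hmpos'
  set d : ℝ := vmax / m with hd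
  have hdL : d * L ≤ σ * B / 4 := by
    rw [div_lt_iff₀ (by positivity)] at hm
    rw [hd, div_mul_eq_mul_div, div_le_iff₀ hmpos']
    linarith
  have hexp : L * (t * vmax) ^ 2 - t * (σ * B - d * L) ≤ -(s / 4) * B ^ 2 := by
    have h2 : t * (d * L) ≤ t * (σ * B / 4) := by gcongr
    have h3 : t * (σ * B) = s * B ^ 2 := by rw [← mul_assoc, htσ]; ring
    nlinarith
  have hposLevel : ∀ u : ℝ, 0 ≤ ∫ v in Set.Ioi u, pd v := fun u => integral_nonneg hpd
  have hleLevel : ∀ u : ℝ, ∫ v in Set.Ioi u, pd v ≤ L := fun u =>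
    setIntegral_le_integral hi (Filter.Eventually.of_forall hpd)
  have hcher : ∀ (u : ℕ → ℝ) (θ : ℝ), |θ| ≤ 1 → θ ^ 2 = (t * vmax) ^ 2 →
      μ {ω | t * (σ * B - d * L) ≤ θ * ((1 / m) * ∑ j ∈ Finset.range m,
        ((Multiset.card ((P ω).filter (· ∈ Set.Ioi (u j))) : ℝ) - ∫ v in Set.Ioi (u j), pd v))}
      ≤ ENNReal.ofReal (exp (-(s / 4) * B ^ 2)) := by
    intro u θ hθ hθ2
    refine (measure_average_poisson_ge_le hmpos
      (X := fun j ω => Multiset.card ((P ω).filter (· ∈ Set.Ioi (u j))))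
      (fun j => hposLevel (u j)) (fun j => hleLevel (u j))
      (fun j n => hpois _ measurableSet_Ioi n) hθ _).trans ?_
    rw [hθ2]
    exact ENNReal.ofReal_le_ofReal (exp_le_exp.2 hexp)
  have hlayer : ∀ (u : ℕ → ℝ) (ω : Ω), vmax * ((1 / m) * ∑ j ∈ Finset.range m,
        ((Multiset.card ((P ω).filter (· ∈ Set.Ioi (u j))) : ℝ) - ∫ v in Set.Ioi (u j), pd v))
      = ((P ω).map (layerSum d m u)).sum - ∫ v, layerSum d m u v * pd v := by
    intro u ω
    rw [← sum_card_filter_eq_sum_layerSum, ← (integrable_layerSum_mul hi d m u).2,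
      Finset.sum_sub_distrib, hd]
    ring
  have habs : |t * vmax| ≤ 1 := by rwa [abs_of_pos (by positivity)]
  have hdInt : Integrable fun v => d * pd v := hi.const_mul d
  have hupper := hcher (fun j => (j + 0) * d) (t * vmax) habs rfl
  have hlower := hcher (fun j => (j + 1) * d) (-(t * vmax)) (by rwa [abs_neg]) (by ring)
  have hmeanU : ∫ v, layerSum d m (fun j => (j + 0) * d) v * pd v ≤ ν + d * L := by
    rw [hν, hL, ← integral_const_mul, ← integral_add hi1 hdInt]
    simp_rw [← add_mul]
    refine hmono _ _ (integrable_layerSum_mul hi _ _ _).1 ?_ fun v hv =>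
      (le_layerSum_upper hmpos (h0.trans hv.1) hv.2).2
    simpa only [add_mul] using! hi1.add hdInt
  have hmeanL : ν - d * L ≤ ∫ v, layerSum d m (fun j => (j + 1) * d) v * pd v := by
    rw [hν, hL, ← integral_const_mul, ← integral_sub hi1 hdInt]
    simp_rw [← sub_mul]
    refine hmono _ _ ?_ (integrable_layerSum_mul hi _ _ _).1 fun v hv =>
      (le_layerSum_lower hmpos (h0.trans hv.1) hv.2).1
    simpa only [sub_mul] using! hi1.sub hdInt
  have hZU : ∀ ω, Z ω ≤ ((P ω).map (layerSum d m (fun j => (j + 0) * d))).sum := by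
    intro ω
    rw [hZ]
    conv_lhs => rw [← Multiset.map_id' (P ω)]
    exact Multiset.sum_map_le_sum_map _ _ fun v hv =>
      (le_layerSum_upper hmpos (h0.trans (hP ω v hv).1) (hP ω v hv).2).1
  have hZL : ∀ ω, ((P ω).map (layerSum d m (fun j => (j + 1) * d))).sum ≤ Z ω := by
    intro ω
    rw [hZ]
    conv_rhs => rw [← Multiset.map_id' (P ω)]
    exact Multiset.sum_map_le_sum_map _ _ fun v hv =>
      (le_layerSum_lower hmpos (h0.trans (hP ω v hv).1) (hP ω v hv).2).2
  rw [two_mul, ENNReal.ofReal_add (exp_pos _).le (exp_pos _).le]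
  refine (measure_mono ?_).trans ((measure_union_le _ _).trans (add_le_add hupper hlower))
  intro ω hω
  have hω' : σ * B < |Z ω - ν| := hω
  rcases lt_abs.1 hω' with h | h
  · left
    rw [Set.mem_ofPred_eq, mul_assoc, hlayer]
    refine mul_le_mul_of_nonneg_left ?_ htpos.le
    linarith [hZU ω]
  · right
    rw [Set.mem_ofPred_eq, neg_mul, mul_assoc, hlayer, ← mul_neg]
    refine mul_le_mul_of_nonneg_left ?_ htpos.le
    linarith [hZL ω]
end

section
/- Fix λ₀ > 0. For all sufficiently large L and any integrated Poisson random variable Z with λ_Z ≥ λ₀, one has P(|Z − μ_Z| > σ_Z·ln L) ≤ L^{−d·ln ln L}, where d > 0 is a constant determined by λ₀, v_min, v_max. -/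
open MeasureTheory ProbabilityTheory Real
open scoped Classical

theorem nullMeasurableSet_of_measure_add_measure_compl_le {Ω : Type*} [MeasurableSpace Ω]
    {μ : Measure Ω} [IsProbabilityMeasure μ] {A : Set Ω} (h : μ A + μ Aᶜ ≤ 1) :
    NullMeasurableSet A μ := by
  set B := toMeasurable μ A
  set C := toMeasurable μ Aᶜ
  have hB : A ⊆ B := subset_toMeasurable μ A
  have hC : Aᶜ ⊆ C := subset_toMeasurable μ Aᶜ
  have hBC : B ∪ C = Set.univ := by
    refine Set.eq_univ_of_forall fun x => ?_
    by_cases hx : x ∈ A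
    · exact Or.inl (hB hx)
    · exact Or.inr (hC hx)
  have hinter : μ (B ∩ C) = 0 := by
    have h1 := measure_union_add_inter (μ := μ) B (measurableSet_toMeasurable μ Aᶜ)
    change μ (B ∪ C) + μ (B ∩ C) = μ B + μ C at h1
    rw [hBC, measure_univ, measure_toMeasurable, measure_toMeasurable] at h1
    rw [← h1] at h
    have h2 : (1 : ENNReal) + μ (B ∩ C) ≤ 1 + 0 := by simpa using h
    exact le_antisymm ((ENNReal.add_le_add_iff_left ENNReal.one_ne_top).1 h2) bot_le
  have hAB : B =ᵐ[μ] A := by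
    refine (ae_le_set.2 ?_).antisymm (LE.le.eventuallyLE hB)
    exact measure_mono_null (Set.inter_subset_inter_right B hC) hinter
  exact (measurableSet_toMeasurable μ A).nullMeasurableSet.congr hAB

theorem tsum_ofReal_poisson_eq_one {m : ℝ} (hm : 0 ≤ m) :
    ∑' n : ℕ, ENNReal.ofReal (Real.exp (-m) * m ^ n / n.factorial) = 1 := by
  have h : HasSum (fun n : ℕ => Real.exp (-m) * m ^ n / n.factorial) 1 :=
    hasSum_one_poissonMeasure ⟨m, hm⟩
  rw [← ENNReal.ofReal_tsum_of_nonneg (fun n => by positivity) h.summable]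
  rw [h.tsum_eq, ENNReal.ofReal_one]

theorem nullMeasurableSet_preimage_of_poisson {Ω : Type*} [MeasurableSpace Ω] {μ : Measure Ω}
    [IsProbabilityMeasure μ] {f : Ω → ℕ} {m : ℝ} (hm : 0 ≤ m)
    (hf : ∀ n : ℕ, μ {ω | f ω = n} = ENNReal.ofReal (Real.exp (-m) * m ^ n / n.factorial))
    (T : Set ℕ) : NullMeasurableSet (f ⁻¹' T) μ := by
  have key : ∀ T : Set ℕ, μ (f ⁻¹' T) ≤ ∑' n : T, μ {ω | f ω = n} := by
    intro T
    refine (measure_mono ?_).trans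
      (measure_biUnion_le μ T.to_countable fun n => {ω | f ω = n})
    intro ω hω
    simpa using hω
  apply nullMeasurableSet_of_measure_add_measure_compl_le
  calc μ (f ⁻¹' T) + μ (f ⁻¹' Tᶜ)
      ≤ ∑' n : T, μ {ω | f ω = n} + ∑' n : ↑Tᶜ, μ {ω | f ω = n} := add_le_add (key T) (key Tᶜ)
    _ = ∑' n : ℕ, μ {ω | f ω = n} :=
        ENNReal.summable.tsum_add_tsum_compl (f := fun n => μ {ω | f ω = n}) ENNReal.summable
    _ = 1 := by simp_rw [hf]; exact tsum_ofReal_poisson_eq_one hm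
    _ ≤ 1 := le_rfl

theorem measure_two_le_of_poisson {Ω : Type*} [MeasurableSpace Ω] {μ : Measure Ω}
    {f : Ω → ℕ} {m : ℝ} (hm : 0 ≤ m)
    (hf : ∀ n : ℕ, μ {ω | f ω = n} = ENNReal.ofReal (Real.exp (-m) * m ^ n / n.factorial)) :
    μ {ω | 2 ≤ f ω} ≤ ENNReal.ofReal (m ^ 2) := by
  calc μ {ω | 2 ≤ f ω} ≤ μ (⋃ n : ℕ, {ω | f ω = n + 2}) := by
        refine measure_mono fun ω hω => Set.mem_iUnion.2 ⟨f ω - 2, ?_⟩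
        simp only [Set.mem_ofPred_eq] at hω ⊢
        omega
    _ ≤ ∑' n : ℕ, μ {ω | f ω = n + 2} := measure_iUnion_le _
    _ ≤ ∑' n : ℕ, ENNReal.ofReal (m ^ 2) *
          ENNReal.ofReal (Real.exp (-m) * m ^ n / n.factorial) := by
        refine ENNReal.tsum_le_tsum fun n => ?_
        rw [hf, ← ENNReal.ofReal_mul (by positivity)]
        refine ENNReal.ofReal_le_ofReal ?_
        have h : Real.exp (-m) * m ^ (n + 2) / (n + 2).factorial
            ≤ Real.exp (-m) * m ^ (n + 2) / n.factorial := by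
          gcongr
          omega
        refine h.trans (le_of_eq ?_)
        ring
    _ = ENNReal.ofReal (m ^ 2) := by
        rw [ENNReal.tsum_mul_left, tsum_ofReal_poisson_eq_one hm, mul_one]

theorem add_one_sub_mul_exp_neg_le {x m : ℝ} (hx : 0 ≤ x) (hm : 0 ≤ m) :
    x + (1 - x) * Real.exp (-m) ≤ Real.exp ((x - 1) * m + m ^ 2) := by
  have h1 : 1 - m ≤ Real.exp (-m) := by linarith [Real.add_one_le_exp (-m)]
  have h2 : Real.exp (-m) ≤ 1 - m + m ^ 2 := by
    rw [Real.exp_neg]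
    have h3 : (Real.exp m)⁻¹ ≤ (1 + m)⁻¹ :=
      inv_anti₀ (by positivity) (by linarith [Real.add_one_le_exp m])
    refine h3.trans ?_
    rw [inv_le_iff_one_le_mul₀ (by positivity)]
    nlinarith [pow_nonneg hm 3]
  have h3 := Real.add_one_le_exp ((x - 1) * m + m ^ 2)
  nlinarith [mul_nonneg hx (sub_nonneg.2 h1)]

/-- The number of points of `P ω` in the set `s`, with multiplicity. -/
noncomputable def pointCount {Ω : Type*} (P : Ω → Multiset ℝ) (s : Set ℝ) (ω : Ω) : ℕ :=
  Multiset.card ((P ω).filter (· ∈ s))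

theorem pointCount_eq_zero {Ω : Type*} {P : Ω → Multiset ℝ} {s : Set ℝ} {ω : Ω} :
    pointCount P s ω = 0 ↔ ∀ v ∈ P ω, v ∉ s := by
  simp [pointCount, Multiset.filter_eq_nil]

/-- The number of points of `P` in any measurable set is Poisson distributed, with mean the
integral of `pd` over that set. -/
def HasPoissonCounts {Ω : Type*} [MeasurableSpace Ω] (μ : Measure Ω) (pd : ℝ → ℝ)
    (P : Ω → Multiset ℝ) : Prop :=
  ∀ s : Set ℝ, MeasurableSet s → ∀ n : ℕ,
    μ {ω | pointCount P s ω = n}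
      = ENNReal.ofReal (Real.exp (-(∫ v in s, pd v)) * (∫ v in s, pd v) ^ n / n.factorial)

namespace HasPoissonCounts

variable {Ω : Type*} [MeasurableSpace Ω] {μ : Measure Ω} {pd : ℝ → ℝ} {P : Ω → Multiset ℝ}

theorem nullMeasurableSet [IsProbabilityMeasure μ] (hP : HasPoissonCounts μ pd P)
    (hpd : ∀ v, 0 ≤ pd v) {s : Set ℝ} (hs : MeasurableSet s) :
    NullMeasurableSet {ω | pointCount P s ω = 0} μ :=
  nullMeasurableSet_preimage_of_poisson (integral_nonneg hpd) (hP s hs) {0}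

theorem integral_prod [IsProbabilityMeasure μ] (hP : HasPoissonCounts μ pd P)
    (hpd : ∀ v, 0 ≤ pd v) (hpd_int : Integrable pd) {A : ℕ → Set ℝ}
    (hA : ∀ j, MeasurableSet (A j)) (hdisj : Pairwise (Function.onFun Disjoint A)) (x : ℕ → ℝ)
    (J : Finset ℕ) {B : Set ℝ} (hB : MeasurableSet B) (hBA : ∀ j ∈ J, Disjoint B (A j)) :
    Integrable (fun ω => (if pointCount P B ω = 0 then (1 : ℝ) else 0) *
      ∏ j ∈ J, if pointCount P (A j) ω = 0 then 1 else x j) μ ∧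
    ∫ ω, (if pointCount P B ω = 0 then (1 : ℝ) else 0) *
      ∏ j ∈ J, (if pointCount P (A j) ω = 0 then 1 else x j) ∂μ
      = Real.exp (-∫ v in B, pd v) *
        ∏ j ∈ J, (x j + (1 - x j) * Real.exp (-∫ v in A j, pd v)) := by
  induction J using Finset.induction_on generalizing B with
  | empty =>
    have hn := hP.nullMeasurableSet hpd hB
    have heq : (fun ω => (if pointCount P B ω = 0 then (1 : ℝ) else 0)) =
        Set.indicator {ω | pointCount P B ω = 0} (fun _ => (1 : ℝ)) := by
      ext ω
      simp [Set.indicator]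
    simp only [Finset.prod_empty, mul_one]
    rw [heq]
    refine ⟨(integrable_const (1 : ℝ)).indicator₀ hn, ?_⟩
    rw [integral_indicator₀ hn, setIntegral_const, Measure.real, hP B hB 0,
      ENNReal.toReal_ofReal (by positivity)]
    simp
  | insert i J hi ih =>
    have h1 := ih hB fun j hj => hBA j (Finset.mem_insert_of_mem hj)
    have h2 := ih (hB.union (hA i)) fun j hj => Set.disjoint_union_left.2
      ⟨hBA j (Finset.mem_insert_of_mem hj), hdisj (by rintro rfl; exact hi hj)⟩
    have heq : (fun ω => (if pointCount P B ω = 0 then (1 : ℝ) else 0) *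
        ∏ j ∈ insert i J, if pointCount P (A j) ω = 0 then 1 else x j) =
        fun ω => x i * ((if pointCount P B ω = 0 then (1 : ℝ) else 0) *
          ∏ j ∈ J, if pointCount P (A j) ω = 0 then 1 else x j) +
        (1 - x i) * ((if pointCount P (B ∪ A i) ω = 0 then (1 : ℝ) else 0) *
          ∏ j ∈ J, if pointCount P (A j) ω = 0 then 1 else x j) := by
      ext ω
      rw [Finset.prod_insert hi]
      have h3 : pointCount P (B ∪ A i) ω = 0 ↔
          pointCount P B ω = 0 ∧
            pointCount P (A i) ω = 0 := by
        simp only [pointCount_eq_zero, Set.mem_union, not_or]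
        exact forall₂_and
      by_cases hb : pointCount P B ω = 0 <;>
        by_cases ha : pointCount P (A i) ω = 0 <;>
        simp only [h3, ha, hb, if_true, if_false, and_true, and_false, and_self] <;> ring
    rw [heq]
    refine ⟨(h1.1.const_mul _).add (h2.1.const_mul _), ?_⟩
    rw [integral_add (h1.1.const_mul _) (h2.1.const_mul _), integral_const_mul,
      integral_const_mul, h1.2, h2.2, Finset.prod_insert hi,
      setIntegral_union (hBA i (Finset.mem_insert_self i J)) (hA i) hpd_int.integrableOn
        hpd_int.integrableOn, neg_add, Real.exp_add]
    ring

theorem lintegral_exp_sum_le [IsProbabilityMeasure μ] (hP : HasPoissonCounts μ pd P)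
    (hpd : ∀ v, 0 ≤ pd v) (hpd_int : Integrable pd) {A : ℕ → Set ℝ}
    (hA : ∀ j, MeasurableSet (A j)) (hdisj : Pairwise (Function.onFun Disjoint A)) (c : ℕ → ℝ)
    (J : Finset ℕ) :
    ∫⁻ ω, ENNReal.ofReal (Real.exp
        (∑ j ∈ J, if pointCount P (A j) ω = 0 then 0 else c j)) ∂μ
      ≤ ENNReal.ofReal (Real.exp (∑ j ∈ J, ((Real.exp (c j) - 1) * (∫ v in A j, pd v)
          + (∫ v in A j, pd v) ^ 2))) := by
  have h := hP.integral_prod hpd hpd_int hA hdisj (fun j => Real.exp (c j)) J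
    MeasurableSet.empty (fun _ _ => Set.empty_disjoint _)
  have heq : ∀ ω, Real.exp
      (∑ j ∈ J, if pointCount P (A j) ω = 0 then 0 else c j) =
      (if pointCount P (∅ : Set ℝ) ω = 0 then (1 : ℝ) else 0) *
      ∏ j ∈ J, if pointCount P (A j) ω = 0 then 1 else Real.exp (c j) := by
    intro ω
    simp [Real.exp_sum, apply_ite Real.exp, pointCount_eq_zero]
  simp_rw [heq]
  rw [← ofReal_integral_eq_lintegral_ofReal h.1
    (Filter.Eventually.of_forall fun ω => (Real.exp_pos _).le.trans_eq (heq ω)), h.2]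
  refine ENNReal.ofReal_le_ofReal ?_
  simp only [Measure.restrict_empty, integral_zero_measure, neg_zero, Real.exp_zero, one_mul,
    Real.exp_sum]
  refine Finset.prod_le_prod (fun j _ => ?_) fun j _ =>
    add_one_sub_mul_exp_neg_le (Real.exp_pos _).le (integral_nonneg hpd)
  have h1 : Real.exp (-∫ v in A j, pd v) ≤ 1 :=
    Real.exp_le_one_iff.2 (neg_nonpos.2 (integral_nonneg hpd))
  nlinarith [Real.exp_pos (c j), Real.exp_pos (-∫ v in A j, pd v)]

end HasPoissonCounts

theorem exp_sub_one_sub_le (y : ℝ) : Real.exp y - 1 ≤ y + y ^ 2 * Real.exp |y| := by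
  have h := Complex.norm_exp_sub_sum_le_norm_mul_exp (y : ℂ) 2
  have h1 : Complex.exp y - ∑ m ∈ Finset.range 2, (y : ℂ) ^ m / m.factorial
      = ((Real.exp y - 1 - y : ℝ) : ℂ) := by
    simp [Finset.sum_range_succ, sub_sub]
  rw [h1, Complex.norm_real, Complex.norm_real, Real.norm_eq_abs, Real.norm_eq_abs, sq_abs] at h
  linarith [le_abs_self (Real.exp y - 1 - y)]

/-- The part of the open interval `(a, b)` on which `⌊v * n⌋₊ = j`. -/
def floorBin (a b : ℝ) (n j : ℕ) : Set ℝ := Set.Ioo a b ∩ {v | ⌊v * n⌋₊ = j}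

/-- The number of bins `floorBin a b n j` that can be nonempty. -/
noncomputable def floorBinCount (b : ℝ) (n : ℕ) : ℕ := ⌊b * n⌋₊ + 1

section floorBin

variable {a b : ℝ}

theorem measurableSet_floorBin (a b : ℝ) (n j : ℕ) : MeasurableSet (floorBin a b n j) :=
  measurableSet_Ioo.inter
    ((Nat.measurable_floor.comp (measurable_id.mul_const (n : ℝ))) (measurableSet_singleton j))

theorem pairwise_disjoint_floorBin (a b : ℝ) (n : ℕ) :
    Pairwise (Function.onFun Disjoint (floorBin a b n)) := fun _ _ hij =>
  Set.disjoint_left.2 fun _ hi hj => hij (hi.2.symm.trans hj.2)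

theorem floor_mem_range_floorBinCount {v : ℝ} (hv : v ∈ Set.Ioo a b) (n : ℕ) :
    ⌊v * n⌋₊ ∈ Finset.range (floorBinCount b n) :=
  Finset.mem_range.2 (Nat.lt_succ_of_le (Nat.floor_mono (by have := hv.2.le; gcongr)))

theorem biUnion_floorBin (a b : ℝ) (n : ℕ) :
    ⋃ j ∈ Finset.range (floorBinCount b n), floorBin a b n j = Set.Ioo a b := by
  ext v
  simp only [Set.mem_iUnion, exists_prop]
  exact ⟨fun ⟨_, _, h⟩ => h.1, fun h => ⟨_, floor_mem_range_floorBinCount h n, h, rfl⟩⟩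

theorem floorBin_subset_Ico (ha : 0 < a) {n : ℕ} (hn : 0 < n) (j : ℕ) :
    floorBin a b n j ⊆ Set.Ico ((j : ℝ) / n) ((j + 1) / n) := by
  rintro v ⟨hv, hj⟩
  have hn' : (0 : ℝ) < n := Nat.cast_pos.2 hn
  have hv0 : 0 ≤ v * n := mul_nonneg (ha.trans hv.1).le hn'.le
  have h := (Nat.floor_eq_iff hv0).1 hj
  exact ⟨(div_le_iff₀ hn').2 h.1, (lt_div_iff₀ hn').2 h.2⟩

theorem sum_setIntegral_floorBin {f : ℝ → ℝ} (hf : IntegrableOn f (Set.Ioo a b)) (n : ℕ) :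
    ∑ j ∈ Finset.range (floorBinCount b n), ∫ v in floorBin a b n j, f v
      = ∫ v in Set.Ioo a b, f v := by
  rw [← integral_biUnion_finset _ (fun j _ => measurableSet_floorBin a b n j)
    (fun _ _ _ _ hij => pairwise_disjoint_floorBin a b n hij)
    (fun j _ => hf.mono_set Set.inter_subset_left), biUnion_floorBin]

theorem eventually_setIntegral_floorBin_le {f : ℝ → ℝ} (hf : Integrable f) (h0 : ∀ v, 0 ≤ f v)
    (ha : 0 < a) {ε : ℝ} (hε : 0 < ε) :
    ∀ᶠ n : ℕ in Filter.atTop, ∀ j, ∫ v in floorBin a b n j, f v ≤ ε := by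
  obtain ⟨δ, hδ, h⟩ := exists_pos_setLIntegral_lt_of_measure_lt (μ := volume)
    (f := fun v => ENNReal.ofReal (f v)) (hasFiniteIntegral_iff_ofReal
      (Filter.Eventually.of_forall h0) |>.1 hf.2).ne (ENNReal.ofReal_pos.2 hε).ne'
  have hlim : Filter.Tendsto (fun n : ℕ => ENNReal.ofReal (1 / (n : ℝ))) Filter.atTop (nhds 0) := by
    simpa using ENNReal.tendsto_ofReal (tendsto_one_div_atTop_nhds_zero_nat (𝕜 := ℝ))
  filter_upwards [hlim.eventually_lt_const hδ, Filter.eventually_gt_atTop 0] with n hn hn0 j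
  have h1 : volume (floorBin a b n j) < δ := by
    refine (measure_mono (floorBin_subset_Ico ha hn0 j)).trans_lt ?_
    rw [Real.volume_Ico]
    convert hn using 2
    ring
  have h2 := (h _ h1).le
  rw [← ofReal_integral_eq_lintegral_ofReal hf.integrableOn (Filter.Eventually.of_forall h0)] at h2
  exact (ENNReal.ofReal_le_ofReal_iff hε.le).1 h2

theorem tendsto_sum_sq_setIntegral_floorBin {f : ℝ → ℝ} (hf : Integrable f) (h0 : ∀ v, 0 ≤ f v)
    (ha : 0 < a) :
    Filter.Tendsto (fun n : ℕ => ∑ j ∈ Finset.range (floorBinCount b n),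
      (∫ v in floorBin a b n j, f v) ^ 2) Filter.atTop (nhds 0) := by
  set Λ := ∫ v in Set.Ioo a b, f v
  have hΛ : 0 ≤ Λ := integral_nonneg h0
  rw [Metric.tendsto_nhds]
  intro ε hε
  filter_upwards [eventually_setIntegral_floorBin_le (b := b) hf h0 ha
    (show 0 < ε / (Λ + 1) by positivity)] with n hn
  rw [Real.dist_0_eq_abs, abs_of_nonneg (Finset.sum_nonneg fun _ _ => sq_nonneg _)]
  calc ∑ j ∈ Finset.range (floorBinCount b n), (∫ v in floorBin a b n j, f v) ^ 2
      ≤ ∑ j ∈ Finset.range (floorBinCount b n),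
          ε / (Λ + 1) * ∫ v in floorBin a b n j, f v := by
        refine Finset.sum_le_sum fun j _ => ?_
        rw [sq]
        exact mul_le_mul_of_nonneg_right (hn j) (integral_nonneg h0)
    _ = ε / (Λ + 1) * Λ := by rw [← Finset.mul_sum, sum_setIntegral_floorBin hf.integrableOn]
    _ < ε := by
        rw [div_mul_eq_mul_div, div_lt_iff₀ (by positivity)]
        nlinarith

theorem eventually_floor_mul_ne {u v : ℝ} (hu : 0 ≤ u) (hv : 0 ≤ v) (huv : u ≠ v) :
    ∀ᶠ n : ℕ in Filter.atTop, ⌊u * n⌋₊ ≠ ⌊v * n⌋₊ := by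
  have h1 := (tendsto_nat_floor_mul_div_atTop hu).comp tendsto_natCast_atTop_atTop
  have h2 := (tendsto_nat_floor_mul_div_atTop hv).comp tendsto_natCast_atTop_atTop
  have h3 := (h1.sub h2).eventually_ne (sub_ne_zero.2 huv)
  filter_upwards [h3] with n hn h
  simp [h] at hn

/-- A lower approximation of `t * v` on `floorBin a b n j`. -/
noncomputable def floorBinValue (t : ℝ) (n j : ℕ) : ℝ := t * (j / n) - |t| / n

theorem floorBinValue_le (ha : 0 < a) (t : ℝ) {n j : ℕ} (hn : 0 < n) {v : ℝ}
    (hv : v ∈ floorBin a b n j) : floorBinValue t n j ≤ t * v := by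
  have h := floorBin_subset_Ico ha hn j hv
  have h1 : |t * (v - j / n)| ≤ |t| * (1 / n) := by
    rw [abs_mul]
    gcongr
    rw [abs_of_nonneg (sub_nonneg.2 h.1)]
    have := h.2.le
    rw [add_div] at this
    linarith
  have h2 := neg_abs_le (t * (v - j / n))
  rw [floorBinValue, div_eq_mul_one_div |t|]
  linarith

theorem tendsto_floorBinValue_floor {v : ℝ} (hv : 0 ≤ v) (t : ℝ) :
    Filter.Tendsto (fun n : ℕ => floorBinValue t n ⌊v * n⌋₊) Filter.atTop (nhds (t * v)) := by
  have h1 := (tendsto_nat_floor_mul_div_atTop hv).comp tendsto_natCast_atTop_atTop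
  have h2 := (h1.const_mul t).sub (tendsto_const_div_atTop_nhds_zero_nat |t|)
  rw [sub_zero] at h2
  exact h2

end floorBin

theorem tendsto_sum_floorBinValue {Ω : Type*} {P : Ω → Multiset ℝ} {a b : ℝ} (ha : 0 < a) {ω : Ω}
    (hmem : ∀ v ∈ P ω, v ∈ Set.Ioo a b) (hnd : (P ω).Nodup) (t : ℝ) :
    Filter.Tendsto (fun n : ℕ => ∑ j ∈ Finset.range (floorBinCount b n),
      if pointCount P (floorBin a b n j) ω = 0 then 0 else floorBinValue t n j)
      Filter.atTop (nhds (t * (P ω).sum)) := by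
  obtain ⟨s, hs⟩ : ∃ s : Finset ℝ, s.val = P ω := ⟨⟨P ω, hnd⟩, rfl⟩
  simp_rw [pointCount_eq_zero]
  rw [← hs] at hmem ⊢
  simp only [Finset.mem_val] at hmem ⊢
  have h0 : ∀ v ∈ s, 0 ≤ v := fun v hv => (ha.trans (hmem v hv).1).le
  have hlim : Filter.Tendsto (fun n : ℕ => ∑ v ∈ s, floorBinValue t n ⌊v * n⌋₊) Filter.atTop
      (nhds (t * s.val.sum)) := by
    rw [Finset.sum_val, Finset.mul_sum]
    exact tendsto_finsetSum s fun v hv => tendsto_floorBinValue_floor (h0 v hv) t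
  have hinj : ∀ᶠ n : ℕ in Filter.atTop, ∀ u ∈ s, ∀ v ∈ s, u ≠ v → ⌊u * n⌋₊ ≠ ⌊v * n⌋₊ := by
    rw [Filter.eventually_all_finset]
    intro u hu
    rw [Filter.eventually_all_finset]
    intro v hv
    by_cases huv : u = v
    · simp [huv]
    · filter_upwards [eventually_floor_mul_ne (h0 u hu) (h0 v hv) huv] with n hn _ using hn
  refine hlim.congr' ?_
  filter_upwards [hinj] with n hn
  have hinj' : Set.InjOn (fun v : ℝ => ⌊v * n⌋₊) s := fun u hu v hv huv =>
    by_contra fun hne => hn u hu v hv hne huv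
  rw [← Finset.sum_image (f := floorBinValue t n) hinj']
  have hsub : s.image (fun v : ℝ => ⌊v * n⌋₊) ⊆ Finset.range (floorBinCount b n) := by
    intro j hj
    obtain ⟨v, hv, rfl⟩ := Finset.mem_image.1 hj
    exact floor_mem_range_floorBinCount (hmem v hv) n
  rw [← Finset.sum_subset hsub]
  · refine Finset.sum_congr rfl fun j hj => (if_neg ?_).symm
    obtain ⟨v, hv, rfl⟩ := Finset.mem_image.1 hj
    exact fun h => h v hv ⟨hmem v hv, rfl⟩
  · intro j _ hj
    refine if_pos fun v hv hvj => hj (Finset.mem_image.2 ⟨v, hv, hvj.2⟩)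

namespace HasPoissonCounts

variable {Ω : Type*} [MeasurableSpace Ω] {μ : Measure Ω} {pd : ℝ → ℝ} {P : Ω → Multiset ℝ}
  {a b : ℝ}

theorem ae_nodup (hP : HasPoissonCounts μ pd P) (hpd : ∀ v, 0 ≤ pd v) (hpd_int : Integrable pd)
    (ha : 0 < a) (hmem : ∀ ω, ∀ v ∈ P ω, v ∈ Set.Ioo a b) : ∀ᵐ ω ∂μ, (P ω).Nodup := by
  have hbound : ∀ n : ℕ, μ {ω | ¬ (P ω).Nodup} ≤ ENNReal.ofReal
      (∑ j ∈ Finset.range (floorBinCount b n), (∫ v in floorBin a b n j, pd v) ^ 2) := by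
    intro n
    calc μ {ω | ¬ (P ω).Nodup}
        ≤ μ (⋃ j ∈ Finset.range (floorBinCount b n),
            {ω | 2 ≤ pointCount P (floorBin a b n j) ω}) := by
          refine measure_mono fun ω hω => ?_
          obtain ⟨v, hv⟩ : ∃ v, 1 < (P ω).count v := by
            by_contra! h
            exact hω (Multiset.nodup_iff_count_le_one.2 h)
          have hvP : v ∈ P ω := Multiset.count_pos.1 (zero_lt_one.trans hv)
          simp only [Set.mem_iUnion, exists_prop]
          refine ⟨_, floor_mem_range_floorBinCount (hmem ω v hvP) n, ?_⟩
          have h1 : Multiset.count v ((P ω).filter (· ∈ floorBin a b n ⌊v * n⌋₊)) =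
              Multiset.count v (P ω) := Multiset.count_filter_of_pos ⟨hmem ω v hvP, rfl⟩
          have h2 := Multiset.count_le_card v ((P ω).filter (· ∈ floorBin a b n ⌊v * n⌋₊))
          rw [h1] at h2
          exact Nat.succ_le_of_lt (hv.trans_le h2)
      _ ≤ ∑ j ∈ Finset.range (floorBinCount b n),
            μ {ω | 2 ≤ pointCount P (floorBin a b n j) ω} := measure_biUnion_finset_le _ _
      _ ≤ ∑ j ∈ Finset.range (floorBinCount b n),
            ENNReal.ofReal ((∫ v in floorBin a b n j, pd v) ^ 2) :=
          Finset.sum_le_sum fun j _ => measure_two_le_of_poisson (integral_nonneg hpd)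
            (hP _ (measurableSet_floorBin a b n j))
      _ = _ := (ENNReal.ofReal_sum_of_nonneg fun _ _ => sq_nonneg _).symm
  have hlim := ENNReal.tendsto_ofReal (tendsto_sum_sq_setIntegral_floorBin (b := b) hpd_int hpd ha)
  rw [ENNReal.ofReal_zero] at hlim
  exact le_antisymm (ge_of_tendsto' hlim hbound) bot_le

theorem aemeasurable_ite [IsProbabilityMeasure μ] (hP : HasPoissonCounts μ pd P)
    (hpd : ∀ v, 0 ≤ pd v) {s : Set ℝ} (hs : MeasurableSet s) (c : ℝ) :
    AEMeasurable (fun ω => if pointCount P s ω = 0 then 0 else c) μ := by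
  have h := (aemeasurable_const (b := c) (μ := μ)).indicator₀
    (hP.nullMeasurableSet hpd hs).compl
  convert h using 1
  ext ω
  by_cases h0 : pointCount P s ω = 0 <;> simp [h0]

theorem ae_tendsto_sum_floorBinValue (hP : HasPoissonCounts μ pd P) (hpd : ∀ v, 0 ≤ pd v)
    (hpd_int : Integrable pd) (ha : 0 < a) (hmem : ∀ ω, ∀ v ∈ P ω, v ∈ Set.Ioo a b) (t : ℝ) :
    ∀ᵐ ω ∂μ, Filter.Tendsto (fun n : ℕ => ∑ j ∈ Finset.range (floorBinCount b n),
      if pointCount P (floorBin a b n j) ω = 0 then 0 else floorBinValue t n j)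
      Filter.atTop (nhds (t * (P ω).sum)) := by
  filter_upwards [hP.ae_nodup hpd hpd_int ha hmem] with ω hω
  exact tendsto_sum_floorBinValue ha (hmem ω) hω t

theorem aemeasurable_mul_sum [IsProbabilityMeasure μ] (hP : HasPoissonCounts μ pd P)
    (hpd : ∀ v, 0 ≤ pd v) (hpd_int : Integrable pd) (ha : 0 < a)
    (hmem : ∀ ω, ∀ v ∈ P ω, v ∈ Set.Ioo a b) (t : ℝ) :
    AEMeasurable (fun ω => t * (P ω).sum) μ := by
  refine aemeasurable_of_tendsto_metrizable_ae Filter.atTop (fun n => ?_)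
    (hP.ae_tendsto_sum_floorBinValue hpd hpd_int ha hmem t)
  exact Finset.aemeasurable_fun_sum _ fun j _ =>
    hP.aemeasurable_ite hpd (measurableSet_floorBin a b n j) _

theorem lintegral_exp_mul_sum_le [IsProbabilityMeasure μ] (hP : HasPoissonCounts μ pd P)
    (hpd : ∀ v, 0 ≤ pd v) (hpd_int : Integrable pd) (ha : 0 < a)
    (hmem : ∀ ω, ∀ v ∈ P ω, v ∈ Set.Ioo a b) (t : ℝ)
    (hexp : IntegrableOn (fun v => (Real.exp (t * v) - 1) * pd v) (Set.Ioo a b)) :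
    ∫⁻ ω, ENNReal.ofReal (Real.exp (t * (P ω).sum)) ∂μ
      ≤ ENNReal.ofReal (Real.exp (∫ v in Set.Ioo a b, (Real.exp (t * v) - 1) * pd v)) := by
  set I := ∫ v in Set.Ioo a b, (Real.exp (t * v) - 1) * pd v
  set X : ℕ → Ω → ℝ := fun n ω => ∑ j ∈ Finset.range (floorBinCount b n),
    if pointCount P (floorBin a b n j) ω = 0 then 0 else floorBinValue t n j
  have hX : ∀ n, AEMeasurable (fun ω => ENNReal.ofReal (Real.exp (X n ω))) μ := fun n =>
    ENNReal.measurable_ofReal.comp_aemeasurable (Real.measurable_exp.comp_aemeasurable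
      (Finset.aemeasurable_fun_sum _ fun j _ =>
        hP.aemeasurable_ite hpd (measurableSet_floorBin a b n j) _))
  have hlim := (tendsto_sum_sq_setIntegral_floorBin (b := b) hpd_int hpd ha).const_add I
  rw [add_zero] at hlim
  replace hlim := ENNReal.tendsto_ofReal ((Real.continuous_exp.tendsto _).comp hlim)
  calc ∫⁻ ω, ENNReal.ofReal (Real.exp (t * (P ω).sum)) ∂μ
      = ∫⁻ ω, Filter.liminf (fun n => ENNReal.ofReal (Real.exp (X n ω))) Filter.atTop ∂μ := by
        refine lintegral_congr_ae ?_
        filter_upwards [hP.ae_tendsto_sum_floorBinValue hpd hpd_int ha hmem t] with ω hω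
        exact (ENNReal.tendsto_ofReal
          ((Real.continuous_exp.tendsto _).comp hω)).liminf_eq.symm
    _ ≤ Filter.liminf (fun n => ∫⁻ ω, ENNReal.ofReal (Real.exp (X n ω)) ∂μ) Filter.atTop :=
        lintegral_liminf_le' hX
    _ ≤ Filter.liminf (fun n : ℕ => ENNReal.ofReal (Real.exp
          (I + ∑ j ∈ Finset.range (floorBinCount b n),
            (∫ v in floorBin a b n j, pd v) ^ 2))) Filter.atTop := by
        refine Filter.liminf_le_liminf ?_
        filter_upwards [Filter.eventually_gt_atTop 0] with n hn
        refine (hP.lintegral_exp_sum_le hpd hpd_int (measurableSet_floorBin a b n)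
          (pairwise_disjoint_floorBin a b n) (floorBinValue t n) _).trans ?_
        refine ENNReal.ofReal_le_ofReal (Real.exp_le_exp.2 ?_)
        rw [Finset.sum_add_distrib, show I = _ from (sum_setIntegral_floorBin hexp n).symm]
        gcongr with j
        rw [← integral_const_mul]
        refine setIntegral_mono_on (hpd_int.integrableOn.const_mul _)
          (hexp.mono_set Set.inter_subset_left) (measurableSet_floorBin a b n j) fun v hv => ?_
        gcongr
        · exact hpd v
        · exact floorBinValue_le ha t hn hv
    _ = ENNReal.ofReal (Real.exp I) := hlim.liminf_eq

theorem measure_lt_mul_sub_le [IsProbabilityMeasure μ] (hP : HasPoissonCounts μ pd P)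
    (hpd : ∀ v, 0 ≤ pd v) (hpd_int : Integrable pd) (ha : 0 < a)
    (hmem : ∀ ω, ∀ v ∈ P ω, v ∈ Set.Ioo a b) (t x : ℝ) :
    μ {ω | x < t * ((P ω).sum - ∫ v in Set.Ioo a b, v * pd v)}
      ≤ ENNReal.ofReal (Real.exp
        (t ^ 2 * Real.exp (|t| * b) * (∫ v in Set.Ioo a b, v ^ 2 * pd v) - x)) := by
  have hcont : ∀ f : ℝ → ℝ, Continuous f → IntegrableOn (fun v => f v * pd v) (Set.Ioo a b) :=
    fun f hf => (IntegrableOn.continuousOn_mul (hf.continuousOn (s := Set.Icc a b))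
      hpd_int.integrableOn isCompact_Icc).mono_set Set.Ioo_subset_Icc_self
  have hexp := hcont (fun v => Real.exp (t * v) - 1) (by fun_prop)
  have hid := hcont (fun v => v) (by fun_prop)
  have hsq := hcont (fun v => v ^ 2) (by fun_prop)
  set m := ∫ v in Set.Ioo a b, v * pd v with hm
  set S := ∫ v in Set.Ioo a b, v ^ 2 * pd v with hS
  have hI : ∫ v in Set.Ioo a b, (Real.exp (t * v) - 1) * pd v
      ≤ t * m + t ^ 2 * Real.exp (|t| * b) * S := by
    rw [hm, hS, ← integral_const_mul, ← integral_const_mul,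
      ← integral_add (hid.const_mul _) (hsq.const_mul _)]
    refine setIntegral_mono_on hexp ((hid.const_mul _).add (hsq.const_mul _)) measurableSet_Ioo
      fun v hv => ?_
    have h1 : Real.exp (t * v) - 1 ≤ t * v + t ^ 2 * Real.exp (|t| * b) * v ^ 2 := by
      have h2 := exp_sub_one_sub_le (t * v)
      have h3 : |t * v| ≤ |t| * b := by
        rw [abs_mul, abs_of_pos (ha.trans hv.1)]
        exact mul_le_mul_of_nonneg_left hv.2.le (abs_nonneg t)
      have h4 : (t * v) ^ 2 * Real.exp |t * v| ≤ (t * v) ^ 2 * Real.exp (|t| * b) := by gcongr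
      linarith
    linarith [mul_le_mul_of_nonneg_right h1 (hpd v)]
  have hZ := hP.aemeasurable_mul_sum hpd hpd_int ha hmem t
  have hmarkov := mul_meas_ge_le_lintegral₀ (μ := μ) (ENNReal.measurable_ofReal.comp_aemeasurable
    (Real.measurable_exp.comp_aemeasurable hZ)) (ENNReal.ofReal (Real.exp (x + t * m)))
  have hle := hmarkov.trans ((hP.lintegral_exp_mul_sum_le hpd hpd_int ha hmem t hexp).trans
    (ENNReal.ofReal_le_ofReal (Real.exp_le_exp.2 hI)))
  have hsub : {ω | x < t * ((P ω).sum - m)} ⊆ {ω | ENNReal.ofReal (Real.exp (x + t * m)) ≤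
      (ENNReal.ofReal ∘ Real.exp ∘ fun ω => t * (P ω).sum) ω} := by
    intro ω hω
    refine ENNReal.ofReal_le_ofReal (Real.exp_le_exp.2 ?_)
    have h : x < t * ((P ω).sum - m) := hω
    linarith
  refine (measure_mono hsub).trans ?_
  rw [← ENNReal.mul_le_mul_iff_right (ENNReal.ofReal_pos.2 (Real.exp_pos (x + t * m))).ne'
    ENNReal.ofReal_ne_top, ← ENNReal.ofReal_mul (Real.exp_pos _).le, ← Real.exp_add]
  refine hle.trans (le_of_eq ?_)
  congr 2
  ring

end HasPoissonCounts

theorem eventually_mul_log_bounds {c : ℝ} (hc : 0 < c) :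
    ∀ᶠ x : ℝ in Filter.atTop, 4 ≤ x ∧ 1 ≤ c * Real.log x ∧ c * Real.log x ≤ √x / 2 := by
  have h1 := (isLittleO_log_rpow_atTop (show (0 : ℝ) < 1 / 2 by norm_num)).bound
    (show 0 < 1 / (2 * c) by positivity)
  filter_upwards [h1, Filter.eventually_ge_atTop 4,
    (Real.tendsto_log_atTop.const_mul_atTop hc).eventually_ge_atTop 1] with x h1 h4 h2
  refine ⟨h4, h2, ?_⟩
  rw [← Real.sqrt_eq_rpow, Real.norm_of_nonneg (Real.sqrt_nonneg x)] at h1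
  calc c * Real.log x ≤ c * (1 / (2 * c) * √x) := by
        gcongr
        exact (Real.le_norm_self _).trans h1
    _ = √x / 2 := by field_simp

/-- For any integrated Poisson random variable with total intensity
`λ_Z ≥ λ₀` and all sufficiently large `L`,
`P(|Z - μ_Z| > σ_Z ln L) ≤ L^(-d ln ln L)` with `d > 0` determined by
`λ₀, vmin, vmax`. -/
theorem integratedPoisson_logL_deviation
    (vmin vmax lam₀ : ℝ) (h0 : 0 < vmin) (h1 : vmin < vmax) (hlam₀ : 0 < lam₀) :
    ∃ d > 0, ∃ L₀ : ℝ, ∀ L : ℝ, L₀ ≤ L →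
      ∀ {Ω : Type} [MeasurableSpace Ω] (μ : Measure Ω), IsProbabilityMeasure μ →
      ∀ (pd : ℝ → ℝ), (∀ v, 0 ≤ pd v) →
      IntegrableOn pd (Set.Ioo vmin vmax) →
      IntegrableOn (fun v => v * pd v) (Set.Ioo vmin vmax) →
      IntegrableOn (fun v => v ^ 2 * pd v) (Set.Ioo vmin vmax) →
      (∀ v, v ∉ Set.Ioo vmin vmax → pd v = 0) →
      lam₀ ≤ ∫ v in Set.Ioo vmin vmax, pd v →
      ∀ (P : Ω → Multiset ℝ), (∀ ω, ∀ v ∈ P ω, v ∈ Set.Ioo vmin vmax) →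
      (∀ s : Set ℝ, MeasurableSet s → ∀ n : ℕ,
        μ {ω | Multiset.card ((P ω).filter (· ∈ s)) = n}
          = ENNReal.ofReal
              (Real.exp (-(∫ v in s, pd v)) * (∫ v in s, pd v) ^ n / n.factorial)) →
      (∀ s t : Set ℝ, MeasurableSet s → MeasurableSet t → Disjoint s t →
        IndepFun (fun ω => Multiset.card ((P ω).filter (· ∈ s)))
                 (fun ω => Multiset.card ((P ω).filter (· ∈ t))) μ) →
      ∀ (Z : Ω → ℝ), (∀ ω, Z ω = (P ω).sum) →
        μ {ω | Real.sqrt (∫ v in Set.Ioo vmin vmax, v ^ 2 * pd v) * Real.log L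
              < |Z ω - ∫ v in Set.Ioo vmin vmax, v * pd v|}
          ≤ ENNReal.ofReal (L ^ (-d * Real.log (Real.log L))) := by
  set κ := vmax / (vmin * √lam₀) with hκ_def
  have hvmax : 0 < vmax := h0.trans h1
  have hκ : 0 < κ := by positivity
  set c := 1 / (2 * κ) with hc_def
  have hc : 0 < c := by positivity
  obtain ⟨L₀, hL₀⟩ := Filter.eventually_atTop.1
    ((Real.tendsto_log_atTop.eventually (eventually_mul_log_bounds hc)).and
      (Filter.eventually_gt_atTop 0))
  refine ⟨c / 4, by positivity, L₀, ?_⟩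
  intro L hL Ω _ μ _ pd hpd hpd_int _ hsq_int hzero hlam P hmem hP _ Z hZ
  obtain ⟨⟨hl4, hθ1, hθ⟩, hL0⟩ := hL₀ L hL
  replace hP : HasPoissonCounts μ pd P := hP
  have hpd_int_univ : Integrable pd := (integrableOn_iff_integrable_of_support_subset fun v hv =>
    by_contra fun h => hv (hzero v h)).1 hpd_int
  set l := Real.log L
  set θ := c * Real.log l with hθ_def
  set m := ∫ v in Set.Ioo vmin vmax, v * pd v
  set S := ∫ v in Set.Ioo vmin vmax, v ^ 2 * pd v with hS_def
  have hl0 : 0 < l := by linarith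
  have hS : vmin ^ 2 * lam₀ ≤ S := by
    refine (mul_le_mul_of_nonneg_left hlam (sq_nonneg vmin)).trans ?_
    rw [← integral_const_mul]
    refine setIntegral_mono_on (hpd_int.const_mul _) hsq_int measurableSet_Ioo fun v hv => ?_
    have := hpd v
    have := hv.1.le
    gcongr
  have hS0 : 0 < S := lt_of_lt_of_le (by positivity) hS
  have hs0 : 0 < √S := Real.sqrt_pos.2 hS0
  have hs : vmin * √lam₀ ≤ √S := by
    refine Real.le_sqrt_of_sq_le ?_
    rwa [mul_pow, Real.sq_sqrt hlam₀.le]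
  have hexponent : (θ / √S) ^ 2 * Real.exp (θ / √S * vmax) * S - θ * l ≤ -(θ * l / 2) := by
    have hdiv : θ / √S * vmax ≤ Real.log l / 2 := by
      calc θ / √S * vmax = θ * (vmax / √S) := by ring
        _ ≤ θ * κ := by
            rw [hκ_def]
            gcongr
        _ = Real.log l / 2 := by rw [hθ_def, hc_def]; field_simp
    have hexp : Real.exp (θ / √S * vmax) ≤ √l := by
      refine (Real.exp_le_exp.2 hdiv).trans_eq ?_
      rw [← Real.log_sqrt hl0.le, Real.exp_log (Real.sqrt_pos.2 hl0)]
    have heq : (θ / √S) ^ 2 * Real.exp (θ / √S * vmax) * S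
        = θ * (θ * Real.exp (θ / √S * vmax)) := by
      rw [div_pow, Real.sq_sqrt hS0.le]
      field_simp
    have hhalf : θ * Real.exp (θ / √S * vmax) ≤ l / 2 := by
      calc θ * Real.exp (θ / √S * vmax) ≤ √l / 2 * √l := by gcongr
        _ = l / 2 := by rw [div_mul_eq_mul_div, Real.mul_self_sqrt hl0.le]
    rw [heq]
    nlinarith
  have htail : ∀ t : ℝ, |t| = θ / √S →
      μ {ω | θ * l < t * ((P ω).sum - m)} ≤ ENNReal.ofReal (Real.exp (-(θ * l / 2))) := by
    intro t ht
    refine (hP.measure_lt_mul_sub_le hpd hpd_int_univ h0 hmem t (θ * l)).trans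
      (ENNReal.ofReal_le_ofReal (Real.exp_le_exp.2 ?_))
    rw [← sq_abs, ht]
    exact hexponent
  have hθs : |θ / √S| = θ / √S := abs_of_pos (by positivity)
  have hsub : {ω | √S * l < |Z ω - m|} ⊆ {ω | θ * l < θ / √S * ((P ω).sum - m)} ∪
      {ω | θ * l < -(θ / √S) * ((P ω).sum - m)} := by
    intro ω hω
    have hω' : √S * l < |(P ω).sum - m| := by rw [← hZ]; exact hω
    have hscale : ∀ y, √S * l < y → θ * l < θ / √S * y := by
      intro y hy
      calc θ * l = θ / √S * (√S * l) := by field_simp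
        _ < θ / √S * y := by gcongr
    rcases lt_abs.1 hω' with h | h
    · exact Or.inl (hscale _ h)
    · refine Or.inr ?_
      rw [Set.mem_ofPred_eq, neg_mul, ← mul_neg]
      exact hscale _ h
  refine (measure_mono hsub).trans ((measure_union_le _ _).trans
    ((add_le_add (htail _ hθs) (htail _ (by rw [abs_neg, hθs]))).trans ?_))
  rw [← ENNReal.ofReal_add (Real.exp_pos _).le (Real.exp_pos _).le,
    Real.rpow_def_of_pos hL0]
  refine ENNReal.ofReal_le_ofReal ?_
  have hsplit : Real.exp (-(θ * l / 2)) = Real.exp (-(θ * l / 4)) * Real.exp (-(θ * l / 4)) := by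
    rw [← Real.exp_add]
    ring_nf
  have hsmall : Real.exp (-(θ * l / 4)) ≤ 1 / 2 := by
    calc Real.exp (-(θ * l / 4)) ≤ Real.exp (-1) := Real.exp_le_exp.2 (by nlinarith)
      _ ≤ 1 / 2 := by
          rw [Real.exp_neg, ← one_div]
          exact one_div_le_one_div_of_le two_pos (by linarith [Real.add_one_le_exp (1 : ℝ)])
  have hpow : l * (-(c / 4) * Real.log l) = -(θ * l / 4) := by rw [hθ_def]; ring
  rw [hpow, hsplit]
  nlinarith [Real.exp_pos (-(θ * l / 4))]
end
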